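/- Let φ : ℝ → ℝ be a nonnegative function and let x : [0, ∞) → (ℝ^M)^N be a solution of the particle dynamics with initial condition x_k(0) = z_k for k = 1, …, N. Then every particle remains for all time in the convex hull of the initial data: for every t ≥ 0 and every k, x_k(t) ∈ convexHull{z_1, …, z_N}. -/

import Mathlib

open Finset

/-- Comparison principle: if, whenever some component `g k` of a finite family is maximal, its
derivative is nonpositive, then an upper bound for the whole family at time `0` persists. -/
theorem le_of_deriv_nonpos_of_isMax {ι : Type*} [Finite ι] {g g' : ι → ℝ → ℝ} {C : ℝ}
    (hg : ∀ t, 0 ≤ t → ∀ k, HasDerivAt (g k) (g' k t) t)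
    (hmax : ∀ t, 0 ≤ t → ∀ k, (∀ j, g j t ≤ g k t) → g' k t ≤ 0)
    (h0 : ∀ k, g k 0 ≤ C) {t : ℝ} (ht : 0 ≤ t) (k : ι) : g k t ≤ C := by
  have key : ∀ ε : ℝ, 0 < ε → g k t ≤ C + ε * t := by
    intro ε hε
    let S : Set ℝ := {s | ∀ k, g k s ≤ C + ε * s}
    have hcl : IsClosed (S ∩ Set.Icc 0 t) := by
      have hS : S ∩ Set.Icc 0 t =
          Set.Icc 0 t ∩ ⋂ k, {s | s ∈ Set.Icc 0 t ∧ g k s ≤ C + ε * s} := by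
        ext s
        simp only [S, Set.mem_inter_iff, Set.mem_iInter, Set.mem_ofPred_eq]
        exact ⟨fun h => ⟨h.2, fun k => ⟨h.2, h.1 k⟩⟩, fun h => ⟨fun k => (h.2 k).2, h.1⟩⟩
      rw [hS]
      refine isClosed_Icc.inter (isClosed_iInter fun k => ?_)
      refine isClosed_Icc.isClosed_le (fun s hs => ?_) (by fun_prop)
      exact (hg s hs.1 k).continuousAt.continuousWithinAt
    have hsub : Set.Icc 0 t ⊆ S := by
      refine hcl.Icc_subset_of_forall_mem_nhdsWithin (fun k => by simpa using h0 k) ?_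
      rintro s ⟨hsS, hs⟩
      refine Filter.eventually_all.2 fun k => ?_
      rcases (hsS k).lt_or_eq with hlt | heq
      · have hB : ContinuousAt (fun y => C + ε * y) s := by fun_prop
        filter_upwards [nhdsWithin_le_nhds
          ((hg s hs.1 k).continuousAt.eventually_lt hB hlt)] with y hy using hy.le
      · have hd : g' k s < ε :=
          (hmax s hs.1 k fun j => (hsS j).trans_eq heq.symm).trans_lt hε
        have hslope := (hg s hs.1 k).hasDerivWithinAt.limsup_slope_le' (s := Set.Ioi s)
          (lt_irrefl s) hd
        filter_upwards [hslope, self_mem_nhdsWithin] with y hy hsy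
        rw [slope_def_field, div_lt_iff₀ (sub_pos.2 hsy)] at hy
        linarith
    exact hsub ⟨ht, le_rfl⟩ k
  have hlim : Filter.Tendsto (fun ε : ℝ => C + ε * t) (nhdsWithin 0 (Set.Ioi 0)) (nhds C) := by
    have hc : Continuous fun ε : ℝ => C + ε * t := by fun_prop
    simpa using (hc.tendsto 0).mono_left nhdsWithin_le_nhds
  exact ge_of_tendsto hlim (by filter_upwards [self_mem_nhdsWithin] with ε hε using key ε hε)

/-- Every particle of the particle clustering dynamics remains for all time in
the convex hull of the initial data points. -/
theorem particles_stay_in_convex_hull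
    {N M : ℕ}
    (φ : ℝ → ℝ) (hφ : ∀ r : ℝ, 0 ≤ φ r)
    (z : Fin N → EuclideanSpace ℝ (Fin M))
    (x : ℝ → Fin N → EuclideanSpace ℝ (Fin M))
    (hsol : ∀ t : ℝ, 0 ≤ t → ∀ k : Fin N,
      HasDerivAt (fun s => x s k)
        (∑ j : Fin N, φ ‖x t k - x t j‖ • (x t j - x t k)) t)
    (hinit : ∀ k : Fin N, x 0 k = z k) :
    ∀ t : ℝ, 0 ≤ t → ∀ k : Fin N,
      x t k ∈ convexHull ℝ (Set.range z) := by
  intro t ht k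
  by_contra hk
  obtain ⟨f, u, hu, huk⟩ := geometric_hahn_banach_closed_point
    (convex_convexHull ℝ (Set.range z))
    ((Set.finite_range z).isClosed_convexHull ℝ) hk
  refine huk.not_ge (le_of_deriv_nonpos_of_isMax (g := fun k s => f (x s k))
    (fun s hs k => f.hasFDerivAt.comp_hasDerivAt s (hsol s hs k)) (fun s _ k hmax => ?_)
    (fun k => ?_) ht k)
  · simp only [map_sum, map_smul, map_sub, smul_eq_mul]
    exact Finset.sum_nonpos fun j _ =>
      mul_nonpos_of_nonneg_of_nonpos (hφ _) (sub_nonpos.2 (hmax j))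
  · rw [hinit]
    exact (hu _ (subset_convexHull ℝ _ (Set.mem_range_self k))).le
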